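/- Let k be a field and let R = k[t,t⁻¹] be the Laurent polynomial ring over k. Let M be a finitely generated R-module such that multiplication by (1 − t) is a bijection from M to M. Then for every field F and every injective ring homomorphism ι : R → F (giving F the structure of an R-module via ι), the base change M ⊗_R F is the zero module. -/

import Mathlib

theorem LaurentPolynomial.not_isUnit_one_sub_T {k : Type*} [CommRing k] [Nontrivial k] (n : ℤ) :
    ¬ IsUnit (1 - T n : LaurentPolynomial k) := by
  intro h
  have h' := h.map (LaurentPolynomial.eval₂ (RingHom.id k) 1)
  simp at h'

/-- A nonunit acting surjectively on a finite module forces a nonzero annihilating scalar. -/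
theorem Module.exists_ne_zero_smul_eq_zero_of_surjective {R M : Type*} [CommRing R]
    [AddCommGroup M] [Module R M] [Module.Finite R M] {a : R} (ha : ¬ IsUnit a)
    (h : Function.Surjective fun m : M => a • m) :
    ∃ r : R, r ≠ 0 ∧ ∀ m : M, r • m = 0 := by
  obtain ⟨r, hr, hrM⟩ := Submodule.exists_sub_one_mem_and_smul_eq_zero_of_fg_of_le_smul
    (Ideal.span {a}) (⊤ : Submodule R M) Module.Finite.fg_top (fun m _ => by
      obtain ⟨n, rfl⟩ := h m
      exact Submodule.smul_mem_smul (Ideal.mem_span_singleton_self a) trivial)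
  refine ⟨r, ?_, fun m => hrM m trivial⟩
  rintro rfl
  rw [zero_sub, neg_mem_iff, Ideal.mem_span_singleton] at hr
  exact ha (isUnit_of_dvd_one hr)

/-- If a scalar annihilates `M` and acts surjectively on `N`, then `M ⊗ N` is zero. -/
theorem TensorProduct.subsingleton_of_smul_eq_zero_of_surjective {R M N : Type*} [CommRing R]
    [AddCommGroup M] [Module R M] [AddCommGroup N] [Module R N] {r : R}
    (hM : ∀ m : M, r • m = 0) (hN : Function.Surjective fun n : N => r • n) :
    Subsingleton (TensorProduct R M N) := by
  refine subsingleton_of_forall_eq 0 fun x => ?_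
  induction x with
  | zero => rfl
  | add x y hx hy => rw [hx, hy, add_zero]
  | tmul m n =>
    obtain ⟨n, rfl⟩ := hN n
    rw [← TensorProduct.smul_tmul, hM, TensorProduct.zero_tmul]

/-- Let `k` be a field and `R = k[t,t⁻¹]` the Laurent polynomial ring over
`k`.  Let `M` be a finitely generated `R`-module such that multiplication by `1 − t` is a
bijection of `M`.  Then for every field `F` and every injective ring homomorphism
`ι : R → F` (giving `F` the structure of an `R`-module via `ι`), the base change
`M ⊗_R F` is the zero module. -/
theorem baseChange_eq_zero_of_one_sub_t_bijective (k : Type*) [Field k]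
    (M : Type*) [AddCommGroup M] [Module (LaurentPolynomial k) M]
    [Module.Finite (LaurentPolynomial k) M]
    (hbij : Function.Bijective fun m : M =>
      ((1 - LaurentPolynomial.T 1 : LaurentPolynomial k)) • m)
    (F : Type*) [Field F] (ι : LaurentPolynomial k →+* F)
    (hι : Function.Injective ι) :
    Subsingleton
      (@TensorProduct (LaurentPolynomial k) _ M F _ _ _ ι.toModule) := by
  obtain ⟨r, hr, hrM⟩ := Module.exists_ne_zero_smul_eq_zero_of_surjective
    (LaurentPolynomial.not_isUnit_one_sub_T 1) hbij.surjective
  let : Module (LaurentPolynomial k) F := ι.toModule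
  refine TensorProduct.subsingleton_of_smul_eq_zero_of_surjective hrM fun x => ⟨(ι r)⁻¹ * x, ?_⟩
  exact mul_inv_cancel_left₀ ((map_ne_zero_iff ι hι).mpr hr) x
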